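/- Let G be a finitely generated subgroup of GL(2,ℝ) and let A ∈ G be a distortion element of G. Then the eigenvalues of A are roots of unity. -/

import Mathlib

open Filter

noncomputable def wordLength {G : Type*} [Group G] (S : Set G) (g : G) : ℕ :=
  sInf {n | ∃ l : List G, (∀ x ∈ l, x ∈ S ∪ S⁻¹) ∧ l.length = n ∧ l.prod = g}

def IsDistorted {G : Type*} [Group G] (f : G) : Prop :=
  ¬ IsOfFinOrder f ∧ ∃ S : Set G, S.Finite ∧ f ∈ Subgroup.closure S ∧
    Tendsto (fun n : ℕ => (wordLength S (f ^ n) : ℝ) / n) atTop (nhds 0)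

open Polynomial Cardinal

open scoped Matrix.Norms.Operator

lemma exists_word_of_mem_closure {G : Type*} [Group G] {S : Set G} {g : G}
    (hg : g ∈ Subgroup.closure S) :
    ∃ l : List G, (∀ x ∈ l, x ∈ S ∪ S⁻¹) ∧ l.length = wordLength S g ∧ l.prod = g := by
  rw [← Subgroup.mem_toSubmonoid, Subgroup.closure_toSubmonoid] at hg
  obtain ⟨l, hl, hprod⟩ := Submonoid.exists_list_of_mem_closure hg
  exact Nat.sInf_mem
    (s := {n | ∃ l : List G, (∀ x ∈ l, x ∈ S ∪ S⁻¹) ∧ l.length = n ∧ l.prod = g})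
    ⟨l.length, l, hl, rfl, hprod⟩

lemma exists_norm_le_pow_wordLength {G R : Type*} [Group G] [NormedRing R] [NormOneClass R]
    (ρ : G →* R) {S : Set G} (hS : S.Finite) :
    ∃ C : ℝ, ∀ g ∈ Subgroup.closure S, ‖ρ g‖ ≤ C ^ wordLength S g := by
  obtain ⟨B, hB⟩ := ((hS.union hS.inv).image fun g ↦ ‖ρ g‖).bddAbove
  refine ⟨max 1 B, fun g hg ↦ ?_⟩
  obtain ⟨l, hl, hlen, rfl⟩ := exists_word_of_mem_closure hg
  rw [← hlen]
  clear hlen hg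
  induction l with
  | nil => simp
  | cons a l ih =>
    have ha : ‖ρ a‖ ≤ max 1 B :=
      (hB (Set.mem_image_of_mem _ (hl a (by simp)))).trans (le_max_right _ _)
    rw [List.prod_cons, map_mul, List.length_cons, pow_succ']
    exact (norm_mul_le _ _).trans (mul_le_mul ha (ih fun x hx ↦ hl x (by simp [hx]))
      (norm_nonneg _) (by positivity))

lemma le_one_of_pow_le_pow_of_tendsto_div {x C : ℝ} {w : ℕ → ℕ}
    (hw : Tendsto (fun n : ℕ ↦ (w n : ℝ) / n) atTop (nhds 0))
    (h : ∀ n, x ^ n ≤ C ^ w n) : x ≤ 1 := by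
  by_contra! hx
  have hlog := Real.log_pos hx
  have hlim : Tendsto (fun n : ℕ ↦ (w n : ℝ) / n * Real.log C) atTop (nhds 0) := by
    simpa using hw.mul_const (Real.log C)
  refine hlog.not_ge (ge_of_tendsto hlim ?_)
  filter_upwards [eventually_gt_atTop 0] with n hn
  have hn' : (0 : ℝ) < n := by exact_mod_cast hn
  have := Real.log_le_log (by positivity) (h n)
  rw [Real.log_pow, Real.log_pow] at this
  rw [div_mul_eq_mul_div, le_div_iff₀ hn']
  linarith

lemma IsDistorted.norm_le_one_of_mem_spectrum {G K R : Type*} [Group G] [NormedField K]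
    [NormedRing R] [NormOneClass R] [NormedAlgebra K R] [CompleteSpace R] {f : G}
    (hf : IsDistorted f) (ρ : G →* R) {k : K} (hk : k ∈ spectrum K (ρ f)) : ‖k‖ ≤ 1 := by
  obtain ⟨-, S, hS, hfS, hw⟩ := hf
  obtain ⟨C, hρ⟩ := exists_norm_le_pow_wordLength ρ hS
  refine le_one_of_pow_le_pow_of_tendsto_div (C := C) hw fun n ↦ ?_
  have hkn : k ^ n ∈ spectrum K (ρ (f ^ n)) := by
    rw [map_pow]
    exact spectrum.pow_mem_pow _ n hk
  rw [← norm_pow]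
  exact (spectrum.norm_le_norm_of_mem hkn).trans (hρ _ (pow_mem hfS n))

/-- An embedding of a countable domain into an uncountable algebraically closed field extends to
any field that is not larger. -/
lemma exists_ringHom_comp_eq_of_countable {R K L : Type} [CommRing R] [IsDomain R] [Countable R]
    [Field K] [Field L] [IsAlgClosed K] [IsAlgClosed L] (hK : ℵ₀ < #K) (hKL : #K ≤ #L)
    {f : R →+* K} {g : R →+* L} (hf : Function.Injective f) (hg : Function.Injective g) :
    ∃ φ : K →+* L, φ.comp f = g := by
  let := f.toAlgebra
  let := g.toAlgebra
  have : FaithfulSMul R K := (faithfulSMul_iff_algebraMap_injective R K).2 hf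
  have : FaithfulSMul R L := (faithfulSMul_iff_algebraMap_injective R L).2 hg
  obtain ⟨s, hs⟩ := exists_isTranscendenceBasis R K
  obtain ⟨t, ht⟩ := exists_isTranscendenceBasis R L
  have hR : #R ≤ ℵ₀ := mk_le_aleph0
  have hst : #s ≤ #t := by
    rw [← IsAlgClosed.cardinal_eq_cardinal_transcendence_basis_of_aleph0_lt' _ hs hR hK,
      ← IsAlgClosed.cardinal_eq_cardinal_transcendence_basis_of_aleph0_lt' _ ht hR
        (hK.trans_le hKL)]
    exact hKL
  obtain ⟨e⟩ := hst
  let A := Algebra.adjoin R (Set.range ((↑) : s → K))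
  have hw : AlgebraicIndependent R fun i : s ↦ (e i : L) := ht.1.comp e e.injective
  let j : A →ₐ[R] L := (MvPolynomial.aeval fun i : s ↦ (e i : L)).comp
    (hs.1.aevalEquiv.symm : A →ₐ[R] MvPolynomial s R)
  have hj : Function.Injective j :=
    Function.Injective.comp (g := MvPolynomial.aeval fun i : s ↦ (e i : L)) hw
      hs.1.aevalEquiv.symm.injective
  let := j.toRingHom.toAlgebra
  have : FaithfulSMul A L := (faithfulSMul_iff_algebraMap_injective A L).2 hj
  have : Algebra.IsAlgebraic A K := hs.isAlgebraic
  let φ : K →ₐ[A] L := IsAlgClosed.lift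
  refine ⟨φ, RingHom.ext fun r ↦ ?_⟩
  exact (φ.commutes (algebraMap R A r)).trans (j.commutes r)

lemma aleph0_lt_mk_complex : ℵ₀ < #ℂ := by
  rw [mk_complex]
  exact aleph0_lt_continuum

lemma mk_complex_le_mk_of_completeSpace (L : Type) [NontriviallyNormedField L]
    [CompleteSpace L] : #ℂ ≤ #L := by
  rw [mk_complex]
  exact continuum_le_cardinal_of_nontriviallyNormedField L

lemma Transcendental.exists_ringHom_one_lt_norm {μ : ℂ} (hμ : Transcendental ℚ μ) :
    ∃ φ : ℂ →+* ℂ, 1 < ‖φ μ‖ := by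
  have hμ0 : μ ≠ 0 := fun h ↦ hμ (h ▸ isAlgebraic_zero)
  obtain ⟨k, hk⟩ := exists_nat_gt ‖μ‖⁻¹
  have hk0 : (k : ℚ) ≠ 0 := by
    rintro h
    have : (k : ℝ) = 0 := by exact_mod_cast h
    rw [this] at hk
    exact hk.not_ge (by positivity)
  have hkμ : Transcendental ℚ ((k : ℚ) • μ) := fun h ↦ hμ <| by
    simpa [smul_smul, hk0] using h.smul (k : ℚ)⁻¹
  have : Countable ℚ[X] := by
    rw [← mk_le_aleph0_iff]
    exact Polynomial.cardinalMk_le_max.trans (by simp)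
  obtain ⟨φ, hφ⟩ := exists_ringHom_comp_eq_of_countable aleph0_lt_mk_complex le_rfl
    (f := (Polynomial.aeval μ : ℚ[X] →ₐ[ℚ] ℂ).toRingHom)
    (g := (Polynomial.aeval ((k : ℚ) • μ) : ℚ[X] →ₐ[ℚ] ℂ).toRingHom)
    (transcendental_iff_injective.1 hμ) (transcendental_iff_injective.1 hkμ)
  refine ⟨φ, ?_⟩
  have h : φ μ = (k : ℚ) • μ := by simpa using RingHom.congr_fun hφ X
  have hpos : 0 < ‖μ‖ := norm_pos_iff.2 hμ0
  rw [h, Rat.smul_def, norm_mul, Rat.cast_natCast, Complex.norm_natCast]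
  rwa [inv_lt_iff_one_lt_mul₀ hpos] at hk

lemma Rat.mem_range_intCast_of_forall_norm_padic_le_one {q : ℚ}
    (h : ∀ (p : ℕ) [Fact p.Prime], ‖(q : ℚ_[p])‖ ≤ 1) : q ∈ Set.range (Int.castRingHom ℚ) := by
  have hden : q.den = 1 := by
    by_contra hne
    obtain ⟨p, hp, hdvd⟩ := Nat.exists_prime_and_dvd hne
    have : Fact p.Prime := ⟨hp⟩
    have hunit := PadicInt.isUnit_iff.1 (PadicInt.isUnit_den q (h p))
    have hlt := (PadicInt.norm_int_lt_one_iff_dvd (p := p) (q.den : ℤ)).2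
      (by exact_mod_cast hdvd)
    rw [Int.cast_natCast, hunit] at hlt
    exact lt_irrefl _ hlt
  exact ⟨q.num, Rat.coe_int_num_of_den_eq_one hden⟩

lemma isIntegral_of_forall_norm_padicComplex_le_one {K : Type*} [Field K] [NumberField K] {x : K}
    (h : ∀ (p : ℕ) [Fact p.Prime] (φ : K →+* ℂ_[p]), ‖φ x‖ ≤ 1) : IsIntegral ℤ x := by
  have hx : IsIntegral ℚ x := Algebra.IsIntegral.isIntegral x
  have hlift : minpoly ℚ x ∈ lifts (Int.castRingHom ℚ) := by
    rw [lifts_iff_coeff_lifts]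
    refine fun n ↦ Rat.mem_range_intCast_of_forall_norm_padic_le_one fun p _ ↦ ?_
    have hmem : (minpoly ℚ x).map (algebraMap ℚ ℂ_[p]) ∈ lifts (NormedField.valuation (K := ℂ_[p])).integer.subtype := by
      refine (IsAlgClosed.splits _).mem_lift_of_roots_mem_range ((minpoly.monic hx).map _) _ ?_
      intro a ha
      have ha' : a ∈ (minpoly ℚ x).rootSet ℂ_[p] := by
        classical
        rw [rootSet, aroots]
        simpa using ha
      rw [← NumberField.Embeddings.range_eval_eq_rootSet_minpoly K ℂ_[p] x] at ha'
      obtain ⟨φ, rfl⟩ := ha'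
      exact ⟨⟨φ x, h p φ⟩, rfl⟩
    rw [lifts_iff_coeff_lifts] at hmem
    obtain ⟨y, hy⟩ := hmem n
    have hnorm : ‖(y : ℂ_[p])‖ ≤ 1 := y.2
    rw [Subring.subtype_apply, coeff_map] at hy
    rwa [hy, eq_ratCast, ← map_ratCast (algebraMap ℚ_[p] ℂ_[p]), norm_algebraMap'] at hnorm
  obtain ⟨P, hP, -, hmonic⟩ := lifts_and_degree_eq_and_monic hlift (minpoly.monic hx)
  refine ⟨P, hmonic, ?_⟩
  have := minpoly.aeval ℚ x
  rwa [← hP, aeval_def, eval₂_map, RingHom.ext_int (RingHom.comp _ _) (algebraMap ℤ K)] at this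

lemma exists_pow_eq_one_of_isAlgebraic {μ : ℂ} (hμ0 : μ ≠ 0) (hμ : IsAlgebraic ℚ μ)
    (h : ∀ (L : Type) [NontriviallyNormedField L] [CompleteSpace L] (φ : ℂ →+* L), ‖φ μ‖ ≤ 1) :
    ∃ k : ℕ, 0 < k ∧ μ ^ k = 1 := by
  let K := IntermediateField.adjoin ℚ {μ}
  have hfin : FiniteDimensional ℚ K :=
    IntermediateField.adjoin.finiteDimensional hμ.isIntegral
  have : NumberField K := { }
  have : Countable K := by
    rw [← mk_le_aleph0_iff]
    exact (Algebra.IsAlgebraic.cardinalMk_le_max ℚ K).trans (by simp)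
  let x : K := IntermediateField.AdjoinSimple.gen ℚ μ
  have hx : (x : ℂ) = μ := rfl
  have hle (L : Type) [NontriviallyNormedField L] [CompleteSpace L] [IsAlgClosed L]
      (ψ : K →+* L) : ‖ψ x‖ ≤ 1 := by
    obtain ⟨φ, hφ⟩ := exists_ringHom_comp_eq_of_countable aleph0_lt_mk_complex
      (mk_complex_le_mk_of_completeSpace L) (algebraMap K ℂ).injective ψ.injective
    rw [← hφ]
    exact h L φ
  obtain ⟨k, hk, hxk⟩ := NumberField.Embeddings.pow_eq_one_of_norm_le_one K ℂ
    (x := x) (fun h0 ↦ hμ0 (by rw [← hx, h0]; rfl))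
    (isIntegral_of_forall_norm_padicComplex_le_one fun p _ ↦ hle ℂ_[p]) (hle ℂ)
  exact ⟨k, hk, by simpa [hx] using congrArg ((↑) : K → ℂ) hxk⟩

/-- The eigenvalues of a distortion element of a finitely generated subgroup of
`GL(2,ℝ)` are roots of unity. -/
theorem eigenvalues_rootOfUnity_of_distorted
    (G : Subgroup (GL (Fin 2) ℝ)) (hG : Group.FG G)
    (A : GL (Fin 2) ℝ) (hA : A ∈ G) (hdist : IsDistorted (⟨A, hA⟩ : G)) :
    ∀ μ : ℂ, (Matrix.charpoly ((A : Matrix (Fin 2) (Fin 2) ℝ).map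
        (algebraMap ℝ ℂ))).IsRoot μ →
      ∃ k : ℕ, 0 < k ∧ μ ^ k = 1 := by
  intro μ hμ
  have hle (L : Type) [NontriviallyNormedField L] [CompleteSpace L] (φ : ℂ →+* L) :
      ‖φ μ‖ ≤ 1 := by
    let ρ : G →* Matrix (Fin 2) (Fin 2) L :=
      ((φ.comp (algebraMap ℝ ℂ)).mapMatrix.toMonoidHom.comp
        (Units.coeHom (Matrix (Fin 2) (Fin 2) ℝ))).comp G.subtype
    have : @CompleteSpace (Matrix (Fin 2) (Fin 2) L) PseudoMetricSpace.toUniformSpace :=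
      FiniteDimensional.complete L _
    refine hdist.norm_le_one_of_mem_spectrum ρ ?_
    rw [Matrix.mem_spectrum_iff_isRoot_charpoly]
    have hρ : ρ ⟨A, hA⟩ = ((A : Matrix (Fin 2) (Fin 2) ℝ).map (algebraMap ℝ ℂ)).map φ := rfl
    rw [hρ, Matrix.charpoly_map]
    exact hμ.map
  have hμ0 : μ ≠ 0 := by
    rintro rfl
    rw [← Matrix.mem_spectrum_iff_isRoot_charpoly] at hμ
    refine spectrum.zero_notMem ℂ ?_ hμ
    exact A.isUnit.map (algebraMap ℝ ℂ).mapMatrix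
  by_cases hμalg : IsAlgebraic ℚ μ
  · exact exists_pow_eq_one_of_isAlgebraic hμ0 hμalg hle
  · obtain ⟨φ, hφ⟩ := Transcendental.exists_ringHom_one_lt_norm hμalg
    exact absurd (hle ℂ φ) hφ.not_ge
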